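/- arXiv:1606.06575 — 5 statements merged into one kernel-verified Lean document; each statement's English description precedes it below -/
import Mathlib

section
/- Let Ω ⊂ ℝ² be a bounded open set and let q ∈ C²(Ω) ∩ C(Ω̄) satisfy Δq = (λ²/L)(2Cq³ − (B²/(2C))q) on Ω. If |q(x,y)| ≤ B/(2C) for every (x,y) ∈ ∂Ω, then −B/(2C) ≤ q(x,y) ≤ B/(2C) for every (x,y) ∈ Ω̄. -/
noncomputable section
open Real

/-- Componentwise Laplacian on `ℝ × ℝ`. -/
noncomputable def lap2 (f : ℝ × ℝ → ℝ) (p : ℝ × ℝ) : ℝ :=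
  deriv (deriv (fun x => f (x, p.2))) p.1 + deriv (deriv (fun y => f (p.1, y))) p.2

theorem deriv_deriv_nonpos_of_isLocalMax {f : ℝ → ℝ} {a : ℝ} (h : IsLocalMax f a)
    (hc : ContinuousAt f a) : deriv (deriv f) a ≤ 0 := by
  by_contra! hpos
  have hmin : IsLocalMin f a := isLocalMin_of_deriv_deriv_pos hpos h.deriv_eq_zero hc
  have hconst : f =ᶠ[nhds a] fun _ => f a := by
    filter_upwards [h, hmin] with x hx hx' using le_antisymm hx hx'
  have hzero : deriv (deriv f) a = 0 := by
    rw [hconst.deriv.deriv_eq]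
    simp
  exact hpos.ne' hzero

theorem lap2_nonpos_of_isLocalMax {f : ℝ × ℝ → ℝ} {p : ℝ × ℝ} (h : IsLocalMax f p)
    (hc : ContinuousAt f p) : lap2 f p ≤ 0 := by
  have hx : ContinuousAt (fun x : ℝ => (x, p.2)) p.1 := by fun_prop
  have hy : ContinuousAt (fun y : ℝ => (p.1, y)) p.2 := by fun_prop
  exact add_nonpos
    (deriv_deriv_nonpos_of_isLocalMax (hx.eventually h)
      (ContinuousAt.comp (f := fun x : ℝ => (x, p.2)) hc hx))
    (deriv_deriv_nonpos_of_isLocalMax (hy.eventually h)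
      (ContinuousAt.comp (f := fun y : ℝ => (p.1, y)) hc hy))

theorem lap2_neg (f : ℝ × ℝ → ℝ) (p : ℝ × ℝ) : lap2 (fun z => -f z) p = -lap2 f p := by
  simp only [lap2, deriv.fun_neg']
  ring

/-- A weak maximum principle: if the Laplacian is positive wherever the function exceeds `M`,
then a bound by `M` on the boundary propagates to the closure. -/
theorem le_of_lap2_pos_of_frontier_le {Ω : Set (ℝ × ℝ)} (hΩo : IsOpen Ω)
    (hΩb : Bornology.IsBounded Ω) {f : ℝ × ℝ → ℝ} (hf : ContinuousOn f (closure Ω)) {M : ℝ}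
    (hlap : ∀ p ∈ Ω, M < f p → 0 < lap2 f p) (hbd : ∀ p ∈ frontier Ω, f p ≤ M) :
    ∀ p ∈ closure Ω, f p ≤ M := by
  intro p hp
  obtain ⟨m, hm, hmax⟩ := hΩb.isCompact_closure.exists_isMaxOn ⟨p, hp⟩ hf
  refine (hmax hp).trans ?_
  by_contra! hM
  have hmΩ : m ∈ Ω := by
    by_contra hn
    exact hM.not_ge (hbd m (by rw [hΩo.frontier_eq]; exact ⟨hm, hn⟩))
  have hnhds : closure Ω ∈ nhds m := Filter.mem_of_superset (hΩo.mem_nhds hmΩ) subset_closure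
  exact (hlap m hmΩ hM).not_ge
    (lap2_nonpos_of_isLocalMax (hmax.isLocalMax hnhds) (hf.continuousAt hnhds))

theorem cubic_pos_of_lt {B C t : ℝ} (hB : 0 < B) (hC : 0 < C) (ht : B / (2 * C) < t) :
    0 < 2 * C * t ^ 3 - B ^ 2 / (2 * C) * t := by
  have hb : 0 < B / (2 * C) := by positivity
  have hfac : 2 * C * t ^ 3 - B ^ 2 / (2 * C) * t =
      2 * C * t * ((t - B / (2 * C)) * (t + B / (2 * C))) := by
    field_simp
    ring
  have h₁ : 0 < t := hb.trans ht
  have h₂ : 0 < t - B / (2 * C) := sub_pos.2 ht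
  rw [hfac]
  positivity

theorem stmt2 (B C L lam : ℝ) (hB : 0 < B) (hC : 0 < C) (hL : 0 < L) (hlam : 0 < lam)
    (Ω : Set (ℝ × ℝ)) (hΩo : IsOpen Ω) (hΩb : Bornology.IsBounded Ω)
    (q : ℝ × ℝ → ℝ)
    (hqd : ContDiffOn ℝ 2 q Ω) (hqc : ContinuousOn q (closure Ω))
    (heq : ∀ p ∈ Ω, lap2 q p = (lam ^ 2 / L) * (2 * C * (q p) ^ 3 - (B ^ 2 / (2 * C)) * q p))
    (hbd : ∀ p ∈ frontier Ω, |q p| ≤ B / (2 * C)) :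
    ∀ p ∈ closure Ω, -(B / (2 * C)) ≤ q p ∧ q p ≤ B / (2 * C) := by
  have hk : 0 < lam ^ 2 / L := by positivity
  have hupper := le_of_lap2_pos_of_frontier_le hΩo hΩb hqc
    (fun p hp hlt => by
      rw [heq p hp]
      exact mul_pos hk (cubic_pos_of_lt hB hC hlt))
    (fun p hp => (abs_le.1 (hbd p hp)).2)
  have hlower := le_of_lap2_pos_of_frontier_le hΩo hΩb hqc.fun_neg
    (fun p hp hlt => by
      rw [lap2_neg, heq p hp]
      have := mul_pos hk (cubic_pos_of_lt hB hC hlt)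
      linarith)
    (fun p hp => neg_le.1 (abs_le.1 (hbd p hp)).1)
  exact fun p hp => ⟨neg_le.1 (hlower p hp), hupper p hp⟩
end
end

section
/- Let U ⊆ ℝ² be an open set invariant under the reflection (x,y) ↦ (−x,y), let f : ℝ → ℝ be continuous and odd, and let c > 0. Suppose q̃ ∈ C¹(U) satisfies q̃(x,y) = −q̃(−x,y) for all (x,y) ∈ U, is C² on U ∖ {x = 0}, and satisfies Δq̃ = c f(q̃) classically on U ∖ {x = 0}. Then q̃ is a weak (distributional) solution on all of U: for every φ ∈ C_c^∞(U), ∫_U (∇q̃·∇φ + c f(q̃) φ) dA = 0. -/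
noncomputable section
open Real MeasureTheory

/-- Partial derivative in the x-direction. -/
noncomputable def pdx (f : ℝ × ℝ → ℝ) (p : ℝ × ℝ) : ℝ := fderiv ℝ f p (1, 0)

/-- Partial derivative in the y-direction. -/
noncomputable def pdy (f : ℝ × ℝ → ℝ) (p : ℝ × ℝ) : ℝ := fderiv ℝ f p (0, 1)

/-- The derivative of a horizontal slice is the partial derivative in the x-direction. -/
theorem deriv_horizontal_slice {g : ℝ × ℝ → ℝ} {p : ℝ × ℝ} (hg : DifferentiableAt ℝ g p) :
    deriv (fun x => g (x, p.2)) p.1 = pdx g p := by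
  have h : HasDerivAt (fun x : ℝ => (x, p.2)) ((1, 0) : ℝ × ℝ) p.1 :=
    (hasDerivAt_id p.1).prodMk (hasDerivAt_const p.1 p.2)
  exact (HasFDerivAt.comp_hasDerivAt p.1 (l := g) hg.hasFDerivAt h).deriv

/-- The derivative of a vertical slice is the partial derivative in the y-direction. -/
theorem deriv_vertical_slice {g : ℝ × ℝ → ℝ} {p : ℝ × ℝ} (hg : DifferentiableAt ℝ g p) :
    deriv (fun y => g (p.1, y)) p.2 = pdy g p := by
  have h : HasDerivAt (fun y : ℝ => (p.1, y)) ((0, 1) : ℝ × ℝ) p.2 :=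
    (hasDerivAt_const p.2 p.1).prodMk (hasDerivAt_id p.2)
  exact (HasFDerivAt.comp_hasDerivAt p.2 (l := g) hg.hasFDerivAt h).deriv

/-- If `g` is differentiable near `p`, with partial derivatives differentiable at `p`, then
`lap2 g p` is the sum of the pure second partial derivatives. -/
theorem lap2_eq_pdx_add_pdy {g : ℝ × ℝ → ℝ} {p : ℝ × ℝ}
    (hg : ∀ᶠ z in nhds p, DifferentiableAt ℝ g z)
    (hx : DifferentiableAt ℝ (pdx g) p) (hy : DifferentiableAt ℝ (pdy g) p) :
    lap2 g p = pdx (pdx g) p + pdy (pdy g) p := by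
  have cx : Filter.Tendsto (fun x : ℝ => (x, p.2)) (nhds p.1) (nhds p) :=
    Continuous.tendsto (by fun_prop) p.1
  have cy : Filter.Tendsto (fun y : ℝ => (p.1, y)) (nhds p.2) (nhds p) :=
    Continuous.tendsto (by fun_prop) p.2
  have ex : deriv (fun x => g (x, p.2)) =ᶠ[nhds p.1] fun x => pdx g (x, p.2) := by
    filter_upwards [cx.eventually hg] with x h
    exact deriv_horizontal_slice h
  have ey : deriv (fun y => g (p.1, y)) =ᶠ[nhds p.2] fun y => pdy g (p.1, y) := by
    filter_upwards [cy.eventually hg] with y h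
    exact deriv_vertical_slice h
  rw [lap2, ex.deriv_eq, ey.deriv_eq, deriv_horizontal_slice hx, deriv_vertical_slice hy]

/-- If a compactly supported continuous vector field `(F, G)` on the plane is differentiable off
the vertical axis, where its divergence agrees with a continuous function `h`, then `h` has
integral zero. -/
theorem integral_eq_zero_of_divergence_off_axis {F G h : ℝ × ℝ → ℝ}
    (hF : Continuous F) (hG : Continuous G) (hh : Continuous h)
    (sF : HasCompactSupport F) (sG : HasCompactSupport G) (sh : HasCompactSupport h)
    (dF : ∀ p : ℝ × ℝ, p.1 ≠ 0 → DifferentiableAt ℝ F p)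
    (dG : ∀ p : ℝ × ℝ, p.1 ≠ 0 → DifferentiableAt ℝ G p)
    (hdiv : ∀ p : ℝ × ℝ, p.1 ≠ 0 → pdx F p + pdy G p = h p) :
    ∫ p, h p = 0 := by
  obtain ⟨R, hR0, hR⟩ := (sF.isCompact.union (sG.isCompact.union
    sh.isCompact)).isBounded.subset_ball_lt 0 0
  have vanish : ∀ k : ℝ × ℝ → ℝ, tsupport k ⊆ Metric.ball 0 R →
      ∀ x y : ℝ, R ≤ |x| ∨ R ≤ |y| → k (x, y) = 0 := by
    intro k hk x y hxy
    by_contra hne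
    have := hk (subset_tsupport k hne)
    rw [mem_ball_zero_iff, Prod.norm_def, max_lt_iff] at this
    exact hxy.elim (not_le.2 this.1) (not_le.2 this.2)
  have vF := vanish F fun p hp => hR (Or.inl hp)
  have vG := vanish G fun p hp => hR (Or.inr (Or.inl hp))
  have vh := vanish h fun p hp => hR (Or.inr (Or.inr hp))
  have absR : R ≤ |R| := le_abs_self R
  have absR' : R ≤ |-R| := by rw [abs_neg]; exact absR
  have outside : ∀ t : ℝ, t ∉ Set.Ioc (-R) R → R ≤ |t| := by
    intro t ht
    by_contra! hlt
    exact ht ⟨(abs_lt.1 hlt).1, (abs_lt.1 hlt).2.le⟩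
  -- On the axis, where the divergence theorem makes no demand, prescribe the divergence `h`.
  let F' : ℝ × ℝ → ℝ × ℝ →L[ℝ] ℝ := fun p =>
    if p.1 = 0 then h p • ContinuousLinearMap.fst ℝ ℝ ℝ else fderiv ℝ F p
  let G' : ℝ × ℝ → ℝ × ℝ →L[ℝ] ℝ := fun p => if p.1 = 0 then 0 else fderiv ℝ G p
  have hsum : ∀ p, F' p (1, 0) + G' p (0, 1) = h p := by
    intro p
    by_cases hp : p.1 = 0
    · simp [F', G', hp]
    · simpa [F', G', hp, pdx, pdy] using hdiv p hp
  have half : ∀ a b : ℝ, (∀ x ∈ Set.Ioo (min a b) (max a b), x ≠ 0) →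
      ∫ x in a..b, ∫ y in (-R)..R, h (x, y) =
        (∫ y in (-R)..R, F (b, y)) - ∫ y in (-R)..R, F (a, y) := by
    intro a b hab
    have key := integral2_divergence_prod_of_hasFDerivAt F G F' G' a (-R) b R
      hF.continuousOn hG.continuousOn
      (fun p hp => by
        have h0 := hab _ hp.1
        simpa [F', h0] using (dF p h0).hasFDerivAt)
      (fun p hp => by
        have h0 := hab _ hp.1
        simpa [G', h0] using (dG p h0).hasFDerivAt)
      (by
        simp only [hsum]
        exact hh.continuousOn.integrableOn_compact (isCompact_uIcc.prod isCompact_uIcc))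
    simp only [hsum] at key
    rw [key]
    simp [fun x => vG x R (Or.inr absR), fun x => vG x (-R) (Or.inr absR')]
  have slice : ∀ x : ℝ, ∫ y, h (x, y) = ∫ y in (-R)..R, h (x, y) := fun x =>
    (intervalIntegral.integral_eq_integral_of_support_subset fun y hy => by
      by_contra hout
      exact hy (vh x y (Or.inr (outside y hout)))).symm
  have cinner : Continuous fun x : ℝ => ∫ y in (-R)..R, h (x, y) :=
    intervalIntegral.continuous_parametric_intervalIntegral_of_continuous' (by fun_prop) _ _
  have houter : ∫ x, ∫ y in (-R)..R, h (x, y) = ∫ x in (-R)..R, ∫ y in (-R)..R, h (x, y) :=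
    (intervalIntegral.integral_eq_integral_of_support_subset fun x hx => by
      by_contra hout
      exact hx (by simp [fun y => vh x y (Or.inl (outside x hout))])).symm
  rw [Measure.volume_eq_prod, integral_prod _ (hh.integrable_of_hasCompactSupport sh)]
  simp only [slice]
  rw [houter, ← intervalIntegral.integral_add_adjacent_intervals
    (cinner.intervalIntegrable (-R) 0) (cinner.intervalIntegrable 0 R), half, half]
  · simp [fun y => vF R y (Or.inl absR), fun y => vF (-R) y (Or.inl absR')]
  · intro x hx
    rw [min_eq_left hR0.le] at hx
    exact hx.1.ne'
  · intro x hx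
    rw [max_eq_right (by linarith)] at hx
    exact hx.2.ne

/-- A product is continuous if its first factor is, and its second factor is continuous on an
open set containing the topological support of the first. -/
theorem continuous_mul_of_tsupport_subset {X : Type*} [TopologicalSpace X] {φ g : X → ℝ}
    {U : Set X} (hU : IsOpen U) (hφ : Continuous φ) (hg : ContinuousOn g U)
    (hs : tsupport φ ⊆ U) : Continuous fun x => φ x * g x :=
  continuous_of_tsupport fun _ hx => hφ.continuousAt.mul
    (hg.continuousAt (hU.mem_nhds (hs (tsupport_mul_subset_left hx))))

/-- A product is differentiable at a point if its first factor is, and its second factor is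
whenever the point lies in the topological support of the first. -/
theorem differentiableAt_mul_of_tsupport {E : Type*} [NormedAddCommGroup E] [NormedSpace ℝ E]
    {φ g : E → ℝ} {x : E} (hφ : DifferentiableAt ℝ φ x)
    (hg : x ∈ tsupport φ → DifferentiableAt ℝ g x) :
    DifferentiableAt ℝ (fun z => φ z * g z) x := by
  by_cases hx : x ∈ tsupport φ
  · exact hφ.mul (hg hx)
  · refine (differentiableAt_const (0 : ℝ)).congr_of_eventuallyEq ?_
    filter_upwards [notMem_tsupport_iff_eventuallyEq.1 hx] with z hz
    simp [hz]

/-- Leibniz rule for a directional derivative of a product, where the second factor need only be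
differentiable on the topological support of the first. -/
theorem fderiv_mul_apply_of_tsupport {E : Type*} [NormedAddCommGroup E] [NormedSpace ℝ E]
    {φ g : E → ℝ} {x : E} (hφ : DifferentiableAt ℝ φ x)
    (hg : x ∈ tsupport φ → DifferentiableAt ℝ g x) (v : E) :
    fderiv ℝ (fun z => φ z * g z) x v = φ x * fderiv ℝ g x v + g x * fderiv ℝ φ x v := by
  by_cases hx : x ∈ tsupport φ
  · simp [fderiv_fun_mul hφ (hg hx)]
  · rw [fderiv_of_notMem_tsupport ℝ hx, image_eq_zero_of_notMem_tsupport hx,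
      fderiv_of_notMem_tsupport ℝ fun h => hx (tsupport_mul_subset_left h)]
    simp

theorem stmt9 (U : Set (ℝ × ℝ)) (hU : IsOpen U)
    (hsym : ∀ p : ℝ × ℝ, p ∈ U → ((-p.1, p.2) : ℝ × ℝ) ∈ U)
    (f : ℝ → ℝ) (hf : Continuous f) (hodd : ∀ x : ℝ, f (-x) = -f x)
    (c : ℝ) (hc : 0 < c)
    (qt : ℝ × ℝ → ℝ)
    (hqt1 : ContDiffOn ℝ 1 qt U)
    (hqtodd : ∀ p ∈ U, qt p = -qt (-p.1, p.2))
    (hqt2 : ContDiffOn ℝ 2 qt (U \ {p : ℝ × ℝ | p.1 = 0}))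
    (heq : ∀ p ∈ U, p.1 ≠ 0 → lap2 qt p = c * f (qt p)) :
    ∀ φ : ℝ × ℝ → ℝ, ContDiff ℝ (⊤ : ℕ∞) φ → HasCompactSupport φ → tsupport φ ⊆ U →
      ∫ p in U, (pdx qt p * pdx φ p + pdy qt p * pdy φ p + c * f (qt p) * φ p) = 0 := by
  intro φ hφ hφc hφU
  have dφ : Differentiable ℝ φ := hφ.differentiable (by simp)
  have cdφ : Continuous (fderiv ℝ φ) := hφ.continuous_fderiv (by simp)
  have cdq : ContinuousOn (fderiv ℝ qt) U := hqt1.continuousOn_fderiv_of_isOpen hU le_rfl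
  have cqx : ContinuousOn (pdx qt) U := cdq.clm_apply continuousOn_const
  have cqy : ContinuousOn (pdy qt) U := cdq.clm_apply continuousOn_const
  have hV : IsOpen (U \ {p : ℝ × ℝ | p.1 = 0}) :=
    hU.sdiff (isClosed_eq continuous_fst continuous_const)
  have ddq : ∀ p ∈ U, p.1 ≠ 0 → DifferentiableAt ℝ (fderiv ℝ qt) p := fun p hp h0 =>
    ((hqt2.contDiffAt (hV.mem_nhds ⟨hp, h0⟩)).fderiv_right (m := 1) (by norm_num)).differentiableAt
      one_ne_zero
  have dqx : ∀ p ∈ U, p.1 ≠ 0 → DifferentiableAt ℝ (pdx qt) p := fun p hp h0 =>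
    (ddq p hp h0).clm_apply (differentiableAt_const _)
  have dqy : ∀ p ∈ U, p.1 ≠ 0 → DifferentiableAt ℝ (pdy qt) p := fun p hp h0 =>
    (ddq p hp h0).clm_apply (differentiableAt_const _)
  have sx : tsupport (pdx φ) ⊆ tsupport φ := tsupport_fderiv_apply_subset ℝ _
  have sy : tsupport (pdy φ) ⊆ tsupport φ := tsupport_fderiv_apply_subset ℝ _
  let h : ℝ × ℝ → ℝ := fun p =>
    pdx φ p * pdx qt p + pdy φ p * pdy qt p + φ p * (c * f (qt p))
  have hh : Continuous h :=
    ((continuous_mul_of_tsupport_subset hU (cdφ.clm_apply continuous_const) cqx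
      (sx.trans hφU)).add
      (continuous_mul_of_tsupport_subset hU (cdφ.clm_apply continuous_const) cqy
        (sy.trans hφU))).add
      (continuous_mul_of_tsupport_subset hU hφ.continuous
        (continuousOn_const.mul (hf.comp_continuousOn hqt1.continuousOn)) hφU)
  have h_zero : ∀ p, p ∉ tsupport φ → h p = 0 := by
    intro p hp
    have h1 : φ p = 0 := image_eq_zero_of_notMem_tsupport hp
    have h2 : pdx φ p = 0 := image_eq_zero_of_notMem_tsupport fun H => hp (sx H)
    have h3 : pdy φ p = 0 := image_eq_zero_of_notMem_tsupport fun H => hp (sy H)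
    simp [h, h1, h2, h3]
  have main : ∫ p, h p = 0 := by
    refine integral_eq_zero_of_divergence_off_axis
      (F := fun p => φ p * pdx qt p) (G := fun p => φ p * pdy qt p)
      (continuous_mul_of_tsupport_subset hU hφ.continuous cqx hφU)
      (continuous_mul_of_tsupport_subset hU hφ.continuous cqy hφU) hh
      hφc.mul_right hφc.mul_right (HasCompactSupport.intro hφc.isCompact fun p hp => h_zero p hp)
      (fun p h0 => differentiableAt_mul_of_tsupport (dφ p) fun hp => dqx p (hφU hp) h0)
      (fun p h0 => differentiableAt_mul_of_tsupport (dφ p) fun hp => dqy p (hφU hp) h0) ?_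
    intro p h0
    have ex : pdx (fun p => φ p * pdx qt p) p = φ p * pdx (pdx qt) p + pdx qt p * pdx φ p :=
      fderiv_mul_apply_of_tsupport (dφ p) (fun hp => dqx p (hφU hp) h0) _
    have ey : pdy (fun p => φ p * pdy qt p) p = φ p * pdy (pdy qt) p + pdy qt p * pdy φ p :=
      fderiv_mul_apply_of_tsupport (dφ p) (fun hp => dqy p (hφU hp) h0) _
    have eq : φ p * (pdx (pdx qt) p + pdy (pdy qt) p) = φ p * (c * f (qt p)) := by
      by_cases hp : p ∈ tsupport φ
      · have hpU := hφU hp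
        have hd : ∀ᶠ z in nhds p, DifferentiableAt ℝ qt z := by
          filter_upwards [hU.mem_nhds hpU] with z hz
          exact (hqt1.contDiffAt (hU.mem_nhds hz)).differentiableAt one_ne_zero
        rw [← lap2_eq_pdx_add_pdy hd (dqx p hpU h0) (dqy p hpU h0), heq p hpU h0]
      · simp [image_eq_zero_of_notMem_tsupport hp]
    rw [ex, ey]
    simp only [h]
    linear_combination eq
  rw [← main, ← setIntegral_eq_integral_of_forall_compl_eq_zero (s := U)
    fun p hp => h_zero p fun H => hp (hφU H)]
  congr 1 with p
  simp only [h]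
  ring
end
end

section
/- Let U ⊆ ℝ² be open and let q ∈ C²(U) satisfy q > 0 on U and Δq = (λ²/L)(2Cq³ − (B²/(2C))q) on U. For any v ∈ C_c^∞(U), setting η := q·v, the following identity holds: ∫_U [ |∇η|² + (λ²/L)(6Cq² − B²/(2C)) η² ] dA = ∫_U [ |∇v|² + (4λ²C/L) q² v² ] q² dA. In particular, the left-hand side (the second variation of the scalar energy H at q in direction η) is non-negative, and it equals zero only if v ≡ 0. -/
noncomputable section
open Real MeasureTheory

/-- A function which is smooth on an open set and vanishes off a closed subset of it is globally
smooth. -/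
lemma contDiff_of_eq_zero_off {E : Type*} [NormedAddCommGroup E] [NormedSpace ℝ E]
    {n : WithTop ℕ∞} {U K : Set E} (hK : IsClosed K) (hKU : K ⊆ U) {g : E → ℝ}
    (hg : ∀ p ∈ U, ContDiffAt ℝ n g p) (hz : ∀ p ∉ K, g p = 0) : ContDiff ℝ n g := by
  rw [contDiff_iff_contDiffAt]
  intro p
  by_cases hp : p ∈ K
  · exact hg p (hKU hp)
  · have h : g =ᶠ[nhds p] fun _ => (0 : ℝ) := by
      filter_upwards [hK.isOpen_compl.mem_nhds hp] with r hr using hz r hr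
    exact contDiffAt_const.congr_of_eventuallyEq h

/-- The integral of a directional derivative of a compactly supported `C¹` function vanishes. -/
lemma integral_fderiv_apply_eq_zero {F : ℝ × ℝ → ℝ} (hF : ContDiff ℝ 1 F)
    (hc : HasCompactSupport F) (w : ℝ × ℝ) : ∫ p, fderiv ℝ F p w = 0 := by
  have hcont : Continuous fun p => fderiv ℝ F p w :=
    (hF.continuous_fderiv one_ne_zero).clm_apply continuous_const
  have hint : Integrable (fun p => fderiv ℝ F p w) :=
    hcont.integrable_of_hasCompactSupport (hc.fderiv_apply (𝕜 := ℝ) w)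
  have h := integral_mul_fderiv_eq_neg_fderiv_mul_of_integrable (𝕜 := ℝ)
    (μ := (volume : Measure (ℝ × ℝ))) (f := fun _ => (1 : ℝ)) (g := F) (v := w)
    (by simp) (by simpa using hint)
    (by simpa using hF.continuous.integrable_of_hasCompactSupport hc)
    (fun _ _ => differentiableAt_const _) (fun x _ => hF.differentiable one_ne_zero x)
  simpa using h

lemma contDiffAt_fderiv_apply {q : ℝ × ℝ → ℝ} {p : ℝ × ℝ} (hq : ContDiffAt ℝ 2 q p)
    (w : ℝ × ℝ) : ContDiffAt ℝ 1 (fun r => fderiv ℝ q r w) p :=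
  (hq.fderiv_right (m := 1) (by norm_num)).clm_apply contDiffAt_const

lemma lap2_eq_of_contDiffAt {q : ℝ × ℝ → ℝ} {p : ℝ × ℝ} (hq : ContDiffAt ℝ 2 q p) :
    lap2 q p = pdx (pdx q) p + pdy (pdy q) p := by
  have hev : ∀ᶠ r in nhds p, DifferentiableAt ℝ q r := by
    filter_upwards [hq.eventually (by simp)] with r hr using hr.differentiableAt two_ne_zero
  have hline1 : ∀ x y : ℝ, HasDerivAt (fun x : ℝ => (x, y)) ((1 : ℝ), (0 : ℝ)) x :=
    fun x y => (hasDerivAt_id x).prodMk (hasDerivAt_const x y)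
  have hline2 : ∀ x y : ℝ, HasDerivAt (fun y : ℝ => (x, y)) ((0 : ℝ), (1 : ℝ)) y :=
    fun x y => (hasDerivAt_const y x).prodMk (hasDerivAt_id y)
  have ht1 : Filter.Tendsto (fun x : ℝ => (x, p.2)) (nhds p.1) (nhds p) :=
    (hline1 p.1 p.2).continuousAt
  have ht2 : Filter.Tendsto (fun y : ℝ => (p.1, y)) (nhds p.2) (nhds p) :=
    (hline2 p.1 p.2).continuousAt
  have h1 : deriv (fun x => q (x, p.2)) =ᶠ[nhds p.1] fun x => pdx q (x, p.2) := by
    filter_upwards [ht1.eventually hev] with x hx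
    exact (hx.hasFDerivAt.comp_hasDerivAt x (hline1 x p.2)).deriv
  have h2 : deriv (fun y => q (p.1, y)) =ᶠ[nhds p.2] fun y => pdy q (p.1, y) := by
    filter_upwards [ht2.eventually hev] with y hy
    exact (hy.hasFDerivAt.comp_hasDerivAt y (hline2 p.1 y)).deriv
  have d1 : DifferentiableAt ℝ (pdx q) p :=
    (contDiffAt_fderiv_apply hq (1, 0)).differentiableAt one_ne_zero
  have d2 : DifferentiableAt ℝ (pdy q) p :=
    (contDiffAt_fderiv_apply hq (0, 1)).differentiableAt one_ne_zero
  have e1 : deriv (fun x => pdx q (x, p.2)) p.1 = pdx (pdx q) p :=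
    (HasFDerivAt.comp_hasDerivAt (l := pdx q) (l' := fderiv ℝ (pdx q) p) p.1 d1.hasFDerivAt
      (hline1 p.1 p.2)).deriv
  have e2 : deriv (fun y => pdy q (p.1, y)) p.2 = pdy (pdy q) p :=
    (HasFDerivAt.comp_hasDerivAt (l := pdy q) (l' := fderiv ℝ (pdy q) p) p.2 d2.hasFDerivAt
      (hline2 p.1 p.2)).deriv
  rw [lap2, h1.deriv_eq, h2.deriv_eq, e1, e2]

lemma fderiv_mul_apply {q v : ℝ × ℝ → ℝ} {p : ℝ × ℝ} (hq : DifferentiableAt ℝ q p)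
    (hv : DifferentiableAt ℝ v p) (w : ℝ × ℝ) :
    fderiv ℝ (fun r => q r * v r) p w = q p * fderiv ℝ v p w + v p * fderiv ℝ q p w := by
  rw [fderiv_fun_mul hq hv]
  simp

/-- The directional derivative of the vector field component `q v² ∂_w q`. -/
lemma fderiv_mul_sq_mul_fderiv_apply {q v : ℝ × ℝ → ℝ} {p : ℝ × ℝ} (hq : ContDiffAt ℝ 2 q p)
    (hv : DifferentiableAt ℝ v p) (w : ℝ × ℝ) :
    fderiv ℝ (fun r => q r * v r * (v r * fderiv ℝ q r w)) p w =
      v p ^ 2 * fderiv ℝ q p w ^ 2 + 2 * q p * v p * fderiv ℝ q p w * fderiv ℝ v p w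
        + q p * v p ^ 2 * fderiv ℝ (fun r => fderiv ℝ q r w) p w := by
  have hqd : DifferentiableAt ℝ q p := hq.differentiableAt two_ne_zero
  have hqw := (contDiffAt_fderiv_apply hq w).differentiableAt one_ne_zero
  rw [fderiv_mul_apply (q := fun r => q r * v r) (v := fun r => v r * fderiv ℝ q r w)
    (hqd.mul hv) (hv.mul hqw), fderiv_mul_apply hqd hv,
    fderiv_mul_apply hv hqw]
  ring

theorem stmt14 (B C L lam : ℝ) (hB : 0 < B) (hC : 0 < C) (hL : 0 < L) (hlam : 0 < lam)
    (U : Set (ℝ × ℝ)) (hU : IsOpen U)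
    (q : ℝ × ℝ → ℝ) (hq : ContDiffOn ℝ 2 q U) (hqpos : ∀ p ∈ U, 0 < q p)
    (heq : ∀ p ∈ U, lap2 q p = (lam ^ 2 / L) * (2 * C * (q p) ^ 3 - (B ^ 2 / (2 * C)) * q p))
    (v : ℝ × ℝ → ℝ) (hv : ContDiff ℝ (⊤ : ℕ∞) v) (hvs : HasCompactSupport v) (hvsupp : tsupport v ⊆ U)
    -- LHS: the second variation of the scalar energy H at q in the direction η := q·v
    (LHS RHS : ℝ)
    (hLHS : LHS = ∫ p in U,
      ((pdx (fun r => q r * v r) p) ^ 2 + (pdy (fun r => q r * v r) p) ^ 2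
        + (lam ^ 2 / L) * (6 * C * (q p) ^ 2 - B ^ 2 / (2 * C)) * (q p * v p) ^ 2))
    (hRHS : RHS = ∫ p in U,
      ((pdx v p) ^ 2 + (pdy v p) ^ 2 + (4 * lam ^ 2 * C / L) * (q p) ^ 2 * (v p) ^ 2)
        * (q p) ^ 2) :
    LHS = RHS ∧ 0 ≤ LHS ∧ (LHS = 0 → ∀ p : ℝ × ℝ, v p = 0) := by
  have hK : IsClosed (tsupport v) := isClosed_tsupport v
  have hvz : ∀ p ∉ tsupport v, v p = 0 := fun p hp => image_eq_zero_of_notMem_tsupport hp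
  have hdvz : ∀ p ∉ tsupport v, fderiv ℝ v p = 0 := fun p hp =>
    image_eq_zero_of_notMem_tsupport fun h => hp (tsupport_fderiv_subset ℝ h)
  have hqat : ∀ p ∈ U, ContDiffAt ℝ 2 q p := fun p hp => hq.contDiffAt (hU.mem_nhds hp)
  have hq1 : ∀ p ∈ U, ContDiffAt ℝ 1 q p := fun p hp => (hqat p hp).of_le (by norm_num)
  have hvat : ∀ {n : ℕ} (p), ContDiffAt ℝ n v p := fun p =>
    hv.contDiffAt.of_le (by exact_mod_cast le_top)
  have hv1 : ∀ p, ContDiffAt ℝ 1 v p := fun p => hvat (n := 1) p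
  have hv2 : ∀ p, ContDiffAt ℝ 2 v p := fun p => hvat (n := 2) p
  have hvd : ∀ p, DifferentiableAt ℝ v p := fun p => (hv1 p).differentiableAt one_ne_zero
  set F : ℝ × ℝ → ℝ × ℝ → ℝ := fun w r => q r * v r * (v r * fderiv ℝ q r w) with hFdef
  have hFz : ∀ w, ∀ p ∉ tsupport v, F w p = 0 := fun w p hp => by simp [hFdef, hvz p hp]
  have hFsm : ∀ w, ContDiff ℝ 1 (F w) := fun w =>
    contDiff_of_eq_zero_off hK hvsupp (fun p hp => ((hq1 p hp).mul (hv1 p)).mul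
      ((hv1 p).mul (contDiffAt_fderiv_apply (hqat p hp) w))) (hFz w)
  have hFc : ∀ w, HasCompactSupport (F w) := fun w => HasCompactSupport.intro hvs (hFz w)
  have hFint : ∀ w, Integrable fun p => fderiv ℝ (F w) p w := fun w =>
    (((hFsm w).continuous_fderiv one_ne_zero).clm_apply
      continuous_const).integrable_of_hasCompactSupport ((hFc w).fderiv_apply (𝕜 := ℝ) w)
  set R : ℝ × ℝ → ℝ := fun p =>
    ((pdx v p) ^ 2 + (pdy v p) ^ 2 + (4 * lam ^ 2 * C / L) * (q p) ^ 2 * (v p) ^ 2)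
      * (q p) ^ 2 with hRdef
  have hRz : ∀ p ∉ tsupport v, R p = 0 := fun p hp => by
    simp [hRdef, pdx, pdy, hvz p hp, hdvz p hp]
  have hRsm : ContDiff ℝ 1 R := by
    refine contDiff_of_eq_zero_off hK hvsupp (fun p hp => ?_) hRz
    have a := hq1 p hp
    have b := hv1 p
    have c : ContDiffAt ℝ 1 (pdx v) p := contDiffAt_fderiv_apply (hv2 p) (1, 0)
    have d : ContDiffAt ℝ 1 (pdy v) p := contDiffAt_fderiv_apply (hv2 p) (0, 1)
    exact (((c.pow 2).add (d.pow 2)).add ((contDiffAt_const.mul (a.pow 2)).mul (b.pow 2))).mul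
      (a.pow 2)
  have hRc : HasCompactSupport R := HasCompactSupport.intro hvs hRz
  have hRint : Integrable R := hRsm.continuous.integrable_of_hasCompactSupport hRc
  have hR0 : ∀ p, 0 ≤ R p := fun p => by positivity
  have hRHS' : RHS = ∫ p, R p := by
    rw [hRHS]
    exact setIntegral_eq_integral_of_forall_compl_eq_zero fun p hp =>
      hRz p fun h => hp (hvsupp h)
  have hpt : ∀ p ∈ U, (pdx (fun r => q r * v r) p) ^ 2 + (pdy (fun r => q r * v r) p) ^ 2
        + (lam ^ 2 / L) * (6 * C * (q p) ^ 2 - B ^ 2 / (2 * C)) * (q p * v p) ^ 2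
      = R p + (fderiv ℝ (F (1, 0)) p (1, 0) + fderiv ℝ (F (0, 1)) p (0, 1)) := by
    intro p hp
    have hqd := (hq1 p hp).differentiableAt one_ne_zero
    have hlap := heq p hp
    rw [lap2_eq_of_contDiffAt (hqat p hp)] at hlap
    have e1 : fderiv ℝ (F (1, 0)) p (1, 0) = _ :=
      fderiv_mul_sq_mul_fderiv_apply (hqat p hp) (hvd p) (1, 0)
    have e2 : fderiv ℝ (F (0, 1)) p (0, 1) = _ :=
      fderiv_mul_sq_mul_fderiv_apply (hqat p hp) (hvd p) (0, 1)
    have e3 : fderiv ℝ (fun r => fderiv ℝ q r (1, 0)) p (1, 0) = pdx (pdx q) p := rfl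
    have e4 : fderiv ℝ (fun r => fderiv ℝ q r (0, 1)) p (0, 1) = pdy (pdy q) p := rfl
    rw [e1, e2, e3, e4, eq_sub_of_add_eq hlap]
    simp only [hRdef, pdx, fderiv_mul_apply hqd (hvd p)]
    rw [show pdy (fun r => q r * v r) p = _ from fderiv_mul_apply hqd (hvd p) (0, 1)]
    simp only [pdy]
    ring
  have hdivz : ∀ w, ∀ p ∉ tsupport v, fderiv ℝ (F w) p w = 0 := fun w p hp => by
    have : p ∉ tsupport (F w) := fun h => hp <| closure_minimal
      (fun r (hr : F w r ≠ 0) => by_contra fun h' => hr (hFz w r h')) hK h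
    rw [image_eq_zero_of_notMem_tsupport fun h => this (tsupport_fderiv_subset ℝ h)]
    simp
  have hdivint : Integrable fun p =>
      fderiv ℝ (F (1, 0)) p (1, 0) + fderiv ℝ (F (0, 1)) p (0, 1) := (hFint _).add (hFint _)
  have hLR : LHS = RHS := by
    rw [hLHS, hRHS', setIntegral_congr_fun hU.measurableSet hpt,
      setIntegral_eq_integral_of_forall_compl_eq_zero, integral_add hRint hdivint,
      integral_add (hFint _) (hFint _),
      integral_fderiv_apply_eq_zero (hFsm _) (hFc _),
      integral_fderiv_apply_eq_zero (hFsm _) (hFc _)]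
    · simp
    · intro p hp
      have hp' : p ∉ tsupport v := fun h => hp (hvsupp h)
      simp [hRz p hp', hdivz _ p hp']
  refine ⟨hLR, ?_, fun h0 p => ?_⟩
  · rw [hLR, hRHS']
    exact integral_nonneg hR0
  · by_cases hp : p ∈ tsupport v
    · rw [hLR, hRHS', integral_eq_zero_iff_of_nonneg hR0 hRint,
        hRsm.continuous.ae_eq_iff_eq volume continuous_zero] at h0
      have hRp : R p = 0 := congrFun h0 p
      by_contra hvp
      have hqp := hqpos p (hvsupp hp)
      have : 0 < R p := by
        have : 0 < (v p) ^ 2 := by positivity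
        simp only [hRdef]
        positivity
      exact this.ne' hRp
    · exact hvz p hp
end
end

section
/- Set A = −B²/(3C). Let Ω ⊂ ℝ² be a bounded open set, let q ∈ C²(Ω̄), let η ∈ C_c^∞(Ω), and define Q_s := q(n₁⊗n₁ − n₂⊗n₂) − (B/(6C))(2ẑ⊗ẑ − n₁⊗n₁ − n₂⊗n₂) and V := η(n₁⊗n₁ − n₂⊗n₂). Then the Landau-de Gennes energy Ī[Q] := ∫_Ω ( (1/2)|∇Q|² + (λ²/L) f_B(Q) ) dA satisfies (d²/dt²)|_{t=0} Ī[Q_s + tV] = 2 ∫_Ω [ |∇η|² + (λ²/L)(6Cq² − B²/(2C)) η² ] dA, where f_B(Q) := (A/2)tr Q² − (B/3)tr Q³ + (C/4)(tr Q²)². -/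
noncomputable section
open Real MeasureTheory Matrix

noncomputable def n1 : Fin 3 → ℝ := ![-(1 / Real.sqrt 2), 1 / Real.sqrt 2, 0]
noncomputable def n2 : Fin 3 → ℝ := ![1 / Real.sqrt 2, 1 / Real.sqrt 2, 0]
noncomputable def zhat : Fin 3 → ℝ := ![0, 0, 1]

/-- `n₁⊗n₁ − n₂⊗n₂`. -/
noncomputable def M1 : Matrix (Fin 3) (Fin 3) ℝ := vecMulVec n1 n1 - vecMulVec n2 n2

/-- `2 ẑ⊗ẑ − n₁⊗n₁ − n₂⊗n₂`. -/
noncomputable def M3 : Matrix (Fin 3) (Fin 3) ℝ :=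
  (2 : ℝ) • vecMulVec zhat zhat - vecMulVec n1 n1 - vecMulVec n2 n2

theorem M1_eq : M1 = !![0, -1, 0; -1, 0, 0; 0, 0, 0] := by
  have h : (Real.sqrt 2)⁻¹ * (Real.sqrt 2)⁻¹ = 1 / 2 := by
    rw [← mul_inv, Real.mul_self_sqrt (by norm_num)]; norm_num
  ext i j
  fin_cases i <;> fin_cases j <;> simp [M1, n1, n2, h] <;> norm_num

theorem M3_eq : M3 = !![-1, 0, 0; 0, -1, 0; 0, 0, 2] := by
  have h : (Real.sqrt 2)⁻¹ * (Real.sqrt 2)⁻¹ = 1 / 2 := by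
    rw [← mul_inv, Real.mul_self_sqrt (by norm_num)]; norm_num
  ext i j
  fin_cases i <;> fin_cases j <;> simp [M3, n1, n2, zhat, h] <;> norm_num

theorem sum_sq_M1_entries (x y : ℝ) :
    ∑ i : Fin 3, ∑ j : Fin 3, ((x * M1 i j) ^ 2 + (y * M1 i j) ^ 2) = 2 * (x ^ 2 + y ^ 2) := by
  simp [M1_eq, Fin.sum_univ_three]
  ring

theorem trace_sq_smul_M1_sub (u b : ℝ) :
    ((u • M1 - b • M3) * (u • M1 - b • M3)).trace = 2 * u ^ 2 + 6 * b ^ 2 := by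
  simp [M1_eq, M3_eq, Matrix.trace, Fin.sum_univ_three]
  ring

theorem trace_cube_smul_M1_sub (u b : ℝ) :
    ((u • M1 - b • M3) * (u • M1 - b • M3) * (u • M1 - b • M3)).trace =
      6 * b * u ^ 2 - 6 * b ^ 3 := by
  simp [M1_eq, M3_eq, Matrix.trace, Fin.sum_univ_three]
  ring

/-- A `C¹` function on the closure of a bounded open set has bounded gradient on that set. -/
theorem exists_norm_fderiv_le_of_contDiffOn_closure {Ω : Set (ℝ × ℝ)} (hΩo : IsOpen Ω)
    (hΩb : Bornology.IsBounded Ω) {f : ℝ × ℝ → ℝ} (hf : ContDiffOn ℝ 1 f (closure Ω)) :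
    ∃ K : ℝ, ∀ p ∈ Ω, ‖fderiv ℝ f p‖ ≤ K := by
  suffices h : ∃ K : ℝ, ∀ p ∈ closure Ω, p ∈ Ω → ‖fderiv ℝ f p‖ ≤ K by
    obtain ⟨K, hK⟩ := h
    exact ⟨K, fun p hp => hK p (subset_closure hp) hp⟩
  refine hΩb.isCompact_closure.induction_on
    (p := fun S => ∃ K : ℝ, ∀ p ∈ S, p ∈ Ω → ‖fderiv ℝ f p‖ ≤ K) ⟨0, by simp⟩ ?_ ?_ ?_
  · rintro S T hST ⟨K, hK⟩
    exact ⟨K, fun p hp => hK p (hST hp)⟩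
  · rintro S T ⟨K, hK⟩ ⟨K', hK'⟩
    refine ⟨max K K', fun p hp hpΩ => hp.elim ?_ ?_⟩
    · exact fun h => (hK p h hpΩ).trans (le_max_left _ _)
    · exact fun h => (hK' p h hpΩ).trans (le_max_right _ _)
  · intro x hx
    have hfx : ContDiffWithinAt ℝ (0 + 1) f (closure Ω) x := by simpa using hf x hx
    obtain ⟨u, hu, -, -, f', hf', hf'c⟩ :=
      (contDiffWithinAt_succ_iff_hasFDerivWithinAt' (by simp)).1 hfx
    rw [Set.insert_eq_of_mem hx] at hu
    have hb : ∀ᶠ y in nhdsWithin x (closure Ω), ‖f' y‖ < ‖f' x‖ + 1 :=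
      hf'c.continuousWithinAt.norm.eventually_lt_const (lt_add_one _)
    refine ⟨_, Filter.inter_mem hu hb, ‖f' x‖ + 1, fun p hp hpΩ => ?_⟩
    have hd : HasFDerivAt f (f' p) p := (hf' p hp.1).hasFDerivAt
      (Filter.mem_of_superset (hΩo.mem_nhds hpΩ) subset_closure)
    rw [hd.fderiv]
    exact le_of_lt hp.2

theorem memLp_top_fderiv_apply_of_contDiffOn_closure {Ω : Set (ℝ × ℝ)} (hΩo : IsOpen Ω)
    (hΩb : Bornology.IsBounded Ω) {f : ℝ × ℝ → ℝ} (hf : ContDiffOn ℝ 1 f (closure Ω))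
    (v : ℝ × ℝ) : MemLp (fun p => fderiv ℝ f p v) ⊤ (volume.restrict Ω) := by
  obtain ⟨K, hK⟩ := exists_norm_fderiv_le_of_contDiffOn_closure hΩo hΩb hf
  refine memLp_top_of_bound (measurable_fderiv_apply_const ℝ f v).aestronglyMeasurable
    (K * ‖v‖) ?_
  filter_upwards [ae_restrict_mem hΩo.measurableSet] with p hp
  exact (fderiv ℝ f p).le_of_opNorm_le (hK p hp) v

theorem memLp_top_of_continuousOn_closure {Ω : Set (ℝ × ℝ)} (hΩo : IsOpen Ω)
    (hΩb : Bornology.IsBounded Ω) {f : ℝ × ℝ → ℝ} (hf : ContinuousOn f (closure Ω)) :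
    MemLp f ⊤ (volume.restrict Ω) := by
  obtain ⟨K, hK⟩ := hΩb.isCompact_closure.exists_bound_of_continuousOn hf
  refine memLp_top_of_bound
    ((hf.mono subset_closure).aestronglyMeasurable hΩo.measurableSet) K ?_
  filter_upwards [ae_restrict_mem hΩo.measurableSet] with p hp
  exact hK p (subset_closure hp)

theorem deriv_deriv_quartic_zero (a₀ a₁ a₂ a₃ a₄ : ℝ) :
    deriv (deriv fun t : ℝ => a₀ + t * a₁ + t ^ 2 * a₂ + t ^ 3 * a₃ + t ^ 4 * a₄) 0 = 2 * a₂ := by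
  have h₁ : (deriv fun t : ℝ => a₀ + t * a₁ + t ^ 2 * a₂ + t ^ 3 * a₃ + t ^ 4 * a₄) =
      fun t => a₁ + t * (2 * a₂) + t ^ 2 * (3 * a₃) + t ^ 3 * (4 * a₄) := by
    funext t
    refine HasDerivAt.deriv ((((((hasDerivAt_id' t).mul_const a₁).const_add a₀).add
      ((hasDerivAt_pow 2 t).mul_const a₂)).add ((hasDerivAt_pow 3 t).mul_const a₃)).add
      ((hasDerivAt_pow 4 t).mul_const a₄) |>.congr_deriv ?_)
    norm_num
    ring
  rw [h₁]
  refine HasDerivAt.deriv (((((hasDerivAt_id' (0 : ℝ)).mul_const (2 * a₂)).const_add a₁).add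
    ((hasDerivAt_pow 2 (0 : ℝ)).mul_const (3 * a₃))).add
    ((hasDerivAt_pow 3 (0 : ℝ)).mul_const (4 * a₄)) |>.congr_deriv ?_)
  norm_num

theorem integral_quartic {α : Type*} [MeasurableSpace α] {μ : Measure α}
    {g₀ g₁ g₂ g₃ g₄ : α → ℝ} (i₀ : Integrable g₀ μ) (i₁ : Integrable g₁ μ)
    (i₂ : Integrable g₂ μ) (i₃ : Integrable g₃ μ) (i₄ : Integrable g₄ μ) (t : ℝ) :
    ∫ p, (g₀ p + t * g₁ p + t ^ 2 * g₂ p + t ^ 3 * g₃ p + t ^ 4 * g₄ p) ∂μ =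
      (∫ p, g₀ p ∂μ) + t * (∫ p, g₁ p ∂μ) + t ^ 2 * (∫ p, g₂ p ∂μ) + t ^ 3 * (∫ p, g₃ p ∂μ)
        + t ^ 4 * (∫ p, g₄ p ∂μ) := by
  have j₁ : Integrable (fun p => g₀ p + t * g₁ p) μ := i₀.add (i₁.const_mul t)
  have j₂ : Integrable (fun p => g₀ p + t * g₁ p + t ^ 2 * g₂ p) μ := j₁.add (i₂.const_mul _)
  have j₃ : Integrable (fun p => g₀ p + t * g₁ p + t ^ 2 * g₂ p + t ^ 3 * g₃ p) μ :=
    j₂.add (i₃.const_mul _)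
  rw [integral_add j₃ (i₄.const_mul _), integral_add j₂ (i₃.const_mul _),
    integral_add j₁ (i₂.const_mul _), integral_add i₀ (i₁.const_mul _)]
  simp only [integral_const_mul]

theorem fderiv_add_mul_mul_const_sub {q η : ℝ × ℝ → ℝ} {p : ℝ × ℝ}
    (hq : DifferentiableAt ℝ q p) (hη : DifferentiableAt ℝ η p) (t m c : ℝ) (v : ℝ × ℝ) :
    fderiv ℝ (fun r => (q r + t * η r) * m - c) p v =
      (fderiv ℝ q p v + t * fderiv ℝ η p v) * m := by
  have h := (((hq.hasFDerivAt.add (hη.hasFDerivAt.const_mul t)).mul_const m).sub_const c).fderiv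
  simp only [Pi.add_apply] at h
  rw [h]
  simp
  ring

theorem stmt15 (B C L lam A : ℝ) (hB : 0 < B) (hC : 0 < C) (hL : 0 < L) (hlam : 0 < lam)
    (hA : A = -B ^ 2 / (3 * C))
    (Ω : Set (ℝ × ℝ)) (hΩo : IsOpen Ω) (hΩb : Bornology.IsBounded Ω)
    (q : ℝ × ℝ → ℝ) (hq : ContDiffOn ℝ 2 q (closure Ω))
    (η : ℝ × ℝ → ℝ) (hη : ContDiff ℝ (⊤ : ℕ∞) η) (hηs : HasCompactSupport η)
    (hηsupp : tsupport η ⊆ Ω)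
    -- the Landau–de Gennes energy Ī
    (Ib : (ℝ × ℝ → Matrix (Fin 3) (Fin 3) ℝ) → ℝ)
    (hIb : ∀ Qm : ℝ × ℝ → Matrix (Fin 3) (Fin 3) ℝ, Ib Qm = ∫ p in Ω,
      ((1 / 2) * (∑ i : Fin 3, ∑ j : Fin 3,
          ((pdx (fun r => Qm r i j) p) ^ 2 + (pdy (fun r => Qm r i j) p) ^ 2))
        + (lam ^ 2 / L) * ((A / 2) * (Qm p * Qm p).trace
            - (B / 3) * (Qm p * Qm p * Qm p).trace
            + (C / 4) * ((Qm p * Qm p).trace) ^ 2)))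
    -- Q_s and the perturbation V
    (Qs V : ℝ × ℝ → Matrix (Fin 3) (Fin 3) ℝ)
    (hQs : ∀ p, Qs p = q p • M1 - (B / (6 * C)) • M3)
    (hV : ∀ p, V p = η p • M1) :
    deriv (deriv (fun t : ℝ => Ib (fun p => Qs p + t • V p))) 0 =
      2 * ∫ p in Ω, ((pdx η p) ^ 2 + (pdy η p) ^ 2
        + (lam ^ 2 / L) * (6 * C * (q p) ^ 2 - B ^ 2 / (2 * C)) * (η p) ^ 2) := by
  have hqc : ContDiffOn ℝ 1 q (closure Ω) := hq.of_le (by norm_num)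
  have hηc : ContDiffOn ℝ 1 η (closure Ω) := (hη.of_le (by simp)).contDiffOn
  have : IsFiniteMeasure (volume.restrict Ω) :=
    isFiniteMeasure_restrict.2 hΩb.measure_lt_top.ne
  have mq := memLp_top_of_continuousOn_closure hΩo hΩb hqc.continuousOn
  have mη := memLp_top_of_continuousOn_closure hΩo hΩb hηc.continuousOn
  have mqx : MemLp (pdx q) ⊤ (volume.restrict Ω) :=
    memLp_top_fderiv_apply_of_contDiffOn_closure hΩo hΩb hqc _
  have mqy : MemLp (pdy q) ⊤ (volume.restrict Ω) :=
    memLp_top_fderiv_apply_of_contDiffOn_closure hΩo hΩb hqc _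
  have mηx : MemLp (pdx η) ⊤ (volume.restrict Ω) :=
    memLp_top_fderiv_apply_of_contDiffOn_closure hΩo hΩb hηc _
  have mηy : MemLp (pdy η) ⊤ (volume.restrict Ω) :=
    memLp_top_fderiv_apply_of_contDiffOn_closure hΩo hΩb hηc _
  have mul : ∀ {f g : ℝ × ℝ → ℝ}, MemLp f ⊤ (volume.restrict Ω) →
      MemLp g ⊤ (volume.restrict Ω) → MemLp (fun p => f p * g p) ⊤ (volume.restrict Ω) :=
    fun hf hg => hg.mul hf
  have mc : ∀ c : ℝ, MemLp (fun _ : ℝ × ℝ => c) ⊤ (volume.restrict Ω) := fun c => memLp_const c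
  obtain ⟨k, hk⟩ : ∃ k, k = lam ^ 2 / L := ⟨_, rfl⟩
  obtain ⟨a, ha⟩ : ∃ a, a = -(B ^ 2 / (2 * C)) := ⟨_, rfl⟩
  obtain ⟨b, hb⟩ : ∃ b, b = B / (6 * C) := ⟨_, rfl⟩
  have hab : A - 2 * B * b + 6 * C * b ^ 2 = a := by
    rw [hA, ha, hb]; field_simp; ring
  obtain ⟨c, hc⟩ : ∃ c, c = 3 * A * b ^ 2 + 2 * B * b ^ 3 + 9 * C * b ^ 4 := ⟨_, rfl⟩
  -- the coefficients of the energy density, a quartic polynomial in `t`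
  let g₀ : ℝ × ℝ → ℝ := fun p => pdx q p * pdx q p + pdy q p * pdy q p
    + (k * C) * ((q p * q p) * (q p * q p)) + (k * a) * (q p * q p) + k * c
  let g₁ : ℝ × ℝ → ℝ := fun p => 2 * (pdx q p * pdx η p) + 2 * (pdy q p * pdy η p)
    + (4 * k * C) * ((q p * q p) * (q p * η p)) + (2 * k * a) * (q p * η p)
  let g₂ : ℝ × ℝ → ℝ := fun p => pdx η p * pdx η p + pdy η p * pdy η p
    + (6 * k * C) * ((q p * q p) * (η p * η p)) + (k * a) * (η p * η p)
  let g₃ : ℝ × ℝ → ℝ := fun p => (4 * k * C) * ((q p * η p) * (η p * η p))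
  let g₄ : ℝ × ℝ → ℝ := fun p => (k * C) * ((η p * η p) * (η p * η p))
  have i₀ : Integrable g₀ (volume.restrict Ω) :=
    (((((mul mqx mqx).add (mul mqy mqy)).add (mul (mc _) (mul (mul mq mq) (mul mq mq)))).add
      (mul (mc _) (mul mq mq))).add (mc _)).integrable le_top
  have i₁ : Integrable g₁ (volume.restrict Ω) :=
    ((((mul (mc _) (mul mqx mηx)).add (mul (mc _) (mul mqy mηy))).add
      (mul (mc _) (mul (mul mq mq) (mul mq mη)))).add (mul (mc _) (mul mq mη))).integrable le_top
  have i₂ : Integrable g₂ (volume.restrict Ω) :=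
    ((((mul mηx mηx).add (mul mηy mηy)).add (mul (mc _) (mul (mul mq mq) (mul mη mη)))).add
      (mul (mc _) (mul mη mη))).integrable le_top
  have i₃ : Integrable g₃ (volume.restrict Ω) :=
    (mul (mc _) (mul (mul mq mη) (mul mη mη))).integrable le_top
  have i₄ : Integrable g₄ (volume.restrict Ω) :=
    (mul (mc _) (mul (mul mη mη) (mul mη mη))).integrable le_top
  have key : (fun t : ℝ => Ib (fun p => Qs p + t • V p)) = fun t => (∫ p in Ω, g₀ p)
      + t * (∫ p in Ω, g₁ p) + t ^ 2 * (∫ p in Ω, g₂ p) + t ^ 3 * (∫ p in Ω, g₃ p)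
      + t ^ 4 * (∫ p in Ω, g₄ p) := by
    funext t
    have hQ : ∀ p, Qs p + t • V p = (q p + t * η p) • M1 - b • M3 := by
      intro p
      rw [hQs, hV, hb, add_smul, mul_smul]
      abel
    have hentry : ∀ i j, (fun r => ((q r + t * η r) • M1 - b • M3) i j) =
        fun r => (q r + t * η r) * M1 i j - b * M3 i j := fun i j => rfl
    rw [hIb, ← integral_quartic i₀ i₁ i₂ i₃ i₄ t]
    refine setIntegral_congr_fun hΩo.measurableSet fun p hp => ?_
    have dq : DifferentiableAt ℝ q p := ((hqc.mono subset_closure).differentiableOn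
      one_ne_zero).differentiableAt (hΩo.mem_nhds hp)
    have dη : DifferentiableAt ℝ η p := (hη.differentiable (by simp)) p
    have hx : ∀ i j, pdx (fun r => (q r + t * η r) * M1 i j - b * M3 i j) p =
        (pdx q p + t * pdx η p) * M1 i j :=
      fun i j => fderiv_add_mul_mul_const_sub dq dη t _ _ _
    have hy : ∀ i j, pdy (fun r => (q r + t * η r) * M1 i j - b * M3 i j) p =
        (pdy q p + t * pdy η p) * M1 i j :=
      fun i j => fderiv_add_mul_mul_const_sub dq dη t _ _ _
    simp only [hQ, hentry, hx, hy, sum_sq_M1_entries, trace_sq_smul_M1_sub,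
      trace_cube_smul_M1_sub, g₀, g₁, g₂, g₃, g₄, ← hk, hc, ← hab]
    ring
  rw [key, deriv_deriv_quartic_zero]
  congr 1
  refine integral_congr_ae (Filter.Eventually.of_forall fun p => ?_)
  simp only [g₂, ← hk, ha]
  ring
end
end

section
/- Set A = −B²/(3C). Let Ω ⊂ ℝ² be a bounded open set, let q_s ∈ C²(Ω̄) satisfy Δq_s = (λ²/L)(2Cq_s³ − (B²/(2C))q_s) on Ω, and define Q_s := q_s(n₁⊗n₁ − n₂⊗n₂) − (B/(6C))(2ẑ⊗ẑ − n₁⊗n₁ − n₂⊗n₂). Suppose there exists η ∈ C_c^∞(Ω) with ∫_Ω [ |∇η|² + (λ²/L)(6Cq_s² − B²/(2C)) η² ] dA < 0, and set V := η(n₁⊗n₁ − n₂⊗n₂). Then for all sufficiently small t ≠ 0 one has Ī[Q_s + tV] < Ī[Q_s], where Ī[Q] := ∫_Ω ( (1/2)|∇Q|² + (λ²/L) f_B(Q) ) dA with f_B(Q) := (A/2)tr Q² − (B/3)tr Q³ + (C/4)(tr Q²)²; in particular Q_s is not a local minimizer of Ī. -/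
noncomputable section
open Real MeasureTheory Matrix

theorem integrable_mul_of_continuousOn {Ω : Set (ℝ × ℝ)} {g η : ℝ × ℝ → ℝ}
    (hg : ContinuousOn g Ω) (hη : Continuous η) {K : Set (ℝ × ℝ)} (hK : IsCompact K)
    (hKΩ : K ⊆ Ω) (hηK : ∀ p ∉ K, η p = 0) : Integrable (fun p => g p * η p) := by
  refine (integrableOn_iff_integrable_of_support_subset (s := K) ?_).1 ?_
  · intro p hp
    by_contra h
    exact hp (by simp [hηK p h])
  · exact ((hg.mono hKΩ).mul hη.continuousOn).integrableOn_compact hK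

theorem fderiv_eq_zero_of_notMem_tsupport {η : ℝ × ℝ → ℝ} {p : ℝ × ℝ} (hp : p ∉ tsupport η) :
    fderiv ℝ η p = 0 := by
  by_contra h
  exact hp (support_fderiv_subset ℝ h)

/-- Integration by parts against a test function, in a fixed direction. -/
theorem setIntegral_fderiv_mul_fderiv {Ω : Set (ℝ × ℝ)} (hΩo : IsOpen Ω) {q η : ℝ × ℝ → ℝ}
    (hq : ContDiffOn ℝ 2 q Ω) (hη : ContDiff ℝ (⊤ : ℕ∞) η) (hηs : HasCompactSupport η)
    (hηΩ : tsupport η ⊆ Ω) (v : ℝ × ℝ) :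
    Integrable (fun p => fderiv ℝ q p v * fderiv ℝ η p v) ∧
    Integrable (fun p => fderiv ℝ (fun r => fderiv ℝ q r v) p v * η p) ∧
    ∫ p in Ω, fderiv ℝ q p v * fderiv ℝ η p v =
      - ∫ p in Ω, fderiv ℝ (fun r => fderiv ℝ q r v) p v * η p := by
  have hq1 : ContDiffOn ℝ 1 (fun r => fderiv ℝ q r v) Ω :=
    (hq.fderiv_of_isOpen hΩo (by norm_num)).clm_apply contDiffOn_const
  have hq2 : ContinuousOn (fun p => fderiv ℝ (fun r => fderiv ℝ q r v) p v) Ω :=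
    (hq1.continuousOn_fderiv_of_isOpen hΩo le_rfl).clm_apply continuousOn_const
  have hdη : Continuous fun p => fderiv ℝ η p v :=
    (hη.continuous_fderiv (by simp)).clm_apply continuous_const
  have h0 : ∀ p ∉ tsupport η, η p = 0 := fun p hp => image_eq_zero_of_notMem_tsupport hp
  have h1 : ∀ p ∉ tsupport η, fderiv ℝ η p v = 0 := fun p hp => by
    simp [fderiv_eq_zero_of_notMem_tsupport hp]
  have i1 := integrable_mul_of_continuousOn hq1.continuousOn hdη hηs hηΩ h1
  have i2 := integrable_mul_of_continuousOn hq2 hη.continuous hηs hηΩ h0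
  have i3 := integrable_mul_of_continuousOn hq1.continuousOn hη.continuous hηs hηΩ h0
  refine ⟨i1, i2, ?_⟩
  rw [setIntegral_eq_integral_of_forall_compl_eq_zero fun p hp => by
      rw [h1 p fun h => hp (hηΩ h), mul_zero],
    setIntegral_eq_integral_of_forall_compl_eq_zero fun p hp => by
      rw [h0 p fun h => hp (hηΩ h), mul_zero]]
  exact integral_mul_fderiv_eq_neg_fderiv_mul_of_integrable i2 i1 i3
    (fun x hx => (hq1.contDiffAt (hΩo.mem_nhds (hηΩ hx))).differentiableAt (by norm_num))
    (fun x _ => hη.differentiable (by simp) x)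

theorem lap2_eq_fderiv {Ω : Set (ℝ × ℝ)} (hΩo : IsOpen Ω) {q : ℝ × ℝ → ℝ}
    (hq : ContDiffOn ℝ 2 q Ω) {p : ℝ × ℝ} (hp : p ∈ Ω) :
    lap2 q p = fderiv ℝ (fun r => fderiv ℝ q r (1, 0)) p (1, 0)
      + fderiv ℝ (fun r => fderiv ℝ q r (0, 1)) p (0, 1) := by
  have hq1 (v : ℝ × ℝ) : ContDiffOn ℝ 1 (fun r => fderiv ℝ q r v) Ω :=
    (hq.fderiv_of_isOpen hΩo (by norm_num)).clm_apply contDiffOn_const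
  have hc1 : ∀ a b : ℝ, HasDerivAt (fun x : ℝ => (x, b)) ((1, 0) : ℝ × ℝ) a := fun a b =>
    (hasDerivAt_id a).prodMk (hasDerivAt_const a b)
  have hc2 : ∀ a b : ℝ, HasDerivAt (fun y : ℝ => (a, y)) ((0, 1) : ℝ × ℝ) b := fun a b =>
    (hasDerivAt_const b a).prodMk (hasDerivAt_id b)
  have hd : ∀ r ∈ Ω, HasFDerivAt q (fderiv ℝ q r) r := fun r hr =>
    ((hq.contDiffAt (hΩo.mem_nhds hr)).differentiableAt (by norm_num)).hasFDerivAt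
  have hd1 (v : ℝ × ℝ) : HasFDerivAt (fun r => fderiv ℝ q r v)
      (fderiv ℝ (fun r => fderiv ℝ q r v) p) p :=
    (((hq1 v).contDiffAt (hΩo.mem_nhds hp)).differentiableAt (by norm_num)).hasFDerivAt
  have e1 : deriv (fun x => q (x, p.2)) =ᶠ[nhds p.1] fun x => fderiv ℝ q (x, p.2) (1, 0) := by
    have : ∀ᶠ x in nhds p.1, (x, p.2) ∈ Ω :=
      (hc1 p.1 p.2).continuousAt.eventually_mem (hΩo.mem_nhds hp)
    filter_upwards [this] with x hx
    exact ((hd _ hx).comp_hasDerivAt x (hc1 x p.2)).deriv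
  have e2 : deriv (fun y => q (p.1, y)) =ᶠ[nhds p.2] fun y => fderiv ℝ q (p.1, y) (0, 1) := by
    have : ∀ᶠ y in nhds p.2, (p.1, y) ∈ Ω :=
      (hc2 p.1 p.2).continuousAt.eventually_mem (hΩo.mem_nhds hp)
    filter_upwards [this] with y hy
    exact ((hd _ hy).comp_hasDerivAt y (hc2 p.1 y)).deriv
  have d1 : HasDerivAt (fun x => fderiv ℝ q (x, p.2) (1, 0))
      (fderiv ℝ (fun r => fderiv ℝ q r (1, 0)) p (1, 0)) p.1 :=
    HasFDerivAt.comp_hasDerivAt (f := fun x => (x, p.2)) p.1 (hd1 (1, 0)) (hc1 p.1 p.2)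
  have d2 : HasDerivAt (fun y => fderiv ℝ q (p.1, y) (0, 1))
      (fderiv ℝ (fun r => fderiv ℝ q r (0, 1)) p (0, 1)) p.2 :=
    HasFDerivAt.comp_hasDerivAt (f := fun y => (p.1, y)) p.2 (hd1 (0, 1)) (hc2 p.1 p.2)
  rw [lap2, e1.deriv_eq, e2.deriv_eq, d1.deriv, d2.deriv]

/-- A function that is `C¹` up to the boundary of a bounded open set has bounded gradient. -/
theorem exists_bound_fderiv {Ω : Set (ℝ × ℝ)} (hΩo : IsOpen Ω) (hΩb : Bornology.IsBounded Ω)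
    {q : ℝ × ℝ → ℝ} (hq : ContDiffOn ℝ 1 q (closure Ω)) :
    ∃ K : ℝ, ∀ p ∈ Ω, ‖fderiv ℝ q p‖ ≤ K := by
  have key : ∃ K : ℝ, ∀ p ∈ closure Ω, p ∈ Ω → ‖fderiv ℝ q p‖ ≤ K := by
    refine hΩb.isCompact_closure.induction_on
      (p := fun s => ∃ K : ℝ, ∀ p ∈ s, p ∈ Ω → ‖fderiv ℝ q p‖ ≤ K) ⟨0, by simp⟩ ?_ ?_ ?_
    · rintro s t hst ⟨K, hK⟩
      exact ⟨K, fun p hp => hK p (hst hp)⟩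
    · rintro s t ⟨K, hK⟩ ⟨K', hK'⟩
      refine ⟨max K K', fun p hp hpΩ => ?_⟩
      rcases hp with hp | hp
      · exact (hK p hp hpΩ).trans (le_max_left _ _)
      · exact (hK' p hp hpΩ).trans (le_max_right _ _)
    · intro x hx
      have h1 : ContDiffWithinAt ℝ (0 + 1) q (closure Ω) x := by simpa using hq x hx
      obtain ⟨u, hu, -, -, f', hf', hc⟩ :=
        (contDiffWithinAt_succ_iff_hasFDerivWithinAt' (by simp)).1 h1
      rw [Set.insert_eq_of_mem hx] at hu
      have hb : ∀ᶠ y in nhdsWithin x (closure Ω), ‖f' y‖ < ‖f' x‖ + 1 :=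
        hc.continuousWithinAt.norm.eventually_lt_const (by linarith)
      refine ⟨_, Filter.inter_mem hu hb, ‖f' x‖ + 1, ?_⟩
      rintro p ⟨hpu, hpb⟩ hpΩ
      have := (hf' p hpu).hasFDerivAt
        (Filter.mem_of_superset (hΩo.mem_nhds hpΩ) subset_closure)
      rw [this.fderiv]
      exact le_of_lt hpb
  obtain ⟨K, hK⟩ := key
  exact ⟨K, fun p hp => hK p (subset_closure hp) hp⟩

/-- The Landau–de Gennes bulk density, written for `Q = g • M1 - b • M3`. -/
theorem bulk_density_eq (A B C b g : ℝ) :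
    (A / 2) * ((g • M1 - b • M3) * (g • M1 - b • M3)).trace
      - (B / 3) * ((g • M1 - b • M3) * (g • M1 - b • M3) * (g • M1 - b • M3)).trace
      + (C / 4) * (((g • M1 - b • M3) * (g • M1 - b • M3)).trace) ^ 2
    = (A / 2) * (2 * g ^ 2 + 6 * b ^ 2) - (B / 3) * (6 * b * g ^ 2 - 6 * b ^ 3)
      + (C / 4) * (2 * g ^ 2 + 6 * b ^ 2) ^ 2 := by
  have hQ : g • M1 - b • M3 = !![b, -g, 0; -g, b, 0; 0, 0, -2 * b] := by
    rw [M1_eq, M3_eq]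
    ext i j
    fin_cases i <;> fin_cases j <;> simp
    ring
  rw [hQ]
  simp [Matrix.trace_fin_three]
  ring

theorem gradient_density_eq (b : ℝ) {g : ℝ × ℝ → ℝ} {p : ℝ × ℝ} (hg : DifferentiableAt ℝ g p) :
    (∑ i : Fin 3, ∑ j : Fin 3,
      ((pdx (fun r => (g r • M1 - b • M3) i j) p) ^ 2
        + (pdy (fun r => (g r • M1 - b • M3) i j) p) ^ 2))
      = 2 * (pdx g p ^ 2 + pdy g p ^ 2) := by
  have h : ∀ i j, fderiv ℝ (fun r => (g r • M1 - b • M3) i j) p = M1 i j • fderiv ℝ g p := by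
    intro i j
    simp only [Matrix.sub_apply, Matrix.smul_apply, smul_eq_mul]
    exact ((hg.hasFDerivAt.mul_const _).sub_const _).fderiv
  simp only [pdx, pdy, h]
  simp [M1_eq, Fin.sum_univ_three]
  ring

/-- A quadratic with negative leading coefficient dominates its cubic and quartic corrections. -/
theorem exists_pos_quartic_neg {S : ℝ} (hS : S < 0) (a b : ℝ) :
    ∃ δ > (0 : ℝ), ∀ t : ℝ, t ≠ 0 → |t| < δ → t ^ 2 * S + t ^ 3 * a + t ^ 4 * b < 0 := by
  have hlim : Filter.Tendsto (fun t : ℝ => S + t * a + t ^ 2 * b) (nhds 0) (nhds S) := by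
    have : Continuous fun t : ℝ => S + t * a + t ^ 2 * b := by fun_prop
    simpa using this.tendsto 0
  obtain ⟨δ, hδ, h⟩ := Metric.eventually_nhds_iff.1 (hlim.eventually_lt_const hS)
  refine ⟨δ, hδ, fun t ht htδ => ?_⟩
  have h1 : S + t * a + t ^ 2 * b < 0 := h (by simpa using htδ)
  have h2 : 0 < t ^ 2 := by positivity
  nlinarith [mul_neg_of_pos_of_neg h2 h1]

theorem stmt16 (B C L lam A : ℝ) (hB : 0 < B) (hC : 0 < C) (hL : 0 < L) (hlam : 0 < lam)
    (hA : A = -B ^ 2 / (3 * C))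
    (Ω : Set (ℝ × ℝ)) (hΩo : IsOpen Ω) (hΩb : Bornology.IsBounded Ω)
    (qs : ℝ × ℝ → ℝ) (hqs : ContDiffOn ℝ 2 qs (closure Ω))
    (heq : ∀ p ∈ Ω, lap2 qs p = (lam ^ 2 / L) * (2 * C * (qs p) ^ 3 - (B ^ 2 / (2 * C)) * qs p))
    (η : ℝ × ℝ → ℝ) (hη : ContDiff ℝ (⊤ : ℕ∞) η) (hηs : HasCompactSupport η)
    (hηsupp : tsupport η ⊆ Ω)
    -- the second variation is negative in the direction η
    (hneg : (∫ p in Ω, ((pdx η p) ^ 2 + (pdy η p) ^ 2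
      + (lam ^ 2 / L) * (6 * C * (qs p) ^ 2 - B ^ 2 / (2 * C)) * (η p) ^ 2)) < 0)
    -- the Landau–de Gennes energy Ī
    (Ib : (ℝ × ℝ → Matrix (Fin 3) (Fin 3) ℝ) → ℝ)
    (hIb : ∀ Qm : ℝ × ℝ → Matrix (Fin 3) (Fin 3) ℝ, Ib Qm = ∫ p in Ω,
      ((1 / 2) * (∑ i : Fin 3, ∑ j : Fin 3,
          ((pdx (fun r => Qm r i j) p) ^ 2 + (pdy (fun r => Qm r i j) p) ^ 2))
        + (lam ^ 2 / L) * ((A / 2) * (Qm p * Qm p).trace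
            - (B / 3) * (Qm p * Qm p * Qm p).trace
            + (C / 4) * ((Qm p * Qm p).trace) ^ 2)))
    (Qs V : ℝ × ℝ → Matrix (Fin 3) (Fin 3) ℝ)
    (hQs : ∀ p, Qs p = qs p • M1 - (B / (6 * C)) • M3)
    (hV : ∀ p, V p = η p • M1) :
    ∃ δ > (0 : ℝ), ∀ t : ℝ, t ≠ 0 → |t| < δ →
      Ib (fun p => Qs p + t • V p) < Ib Qs := by
  set k := lam ^ 2 / L
  set b := B / (6 * C) with hb
  have hqΩ : ContDiffOn ℝ 2 qs Ω := hqs.mono subset_closure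
  have hqd : ∀ p ∈ Ω, DifferentiableAt ℝ qs p := fun p hp =>
    (hqΩ.contDiffAt (hΩo.mem_nhds hp)).differentiableAt (by norm_num)
  have hηd : Differentiable ℝ η := hη.differentiable (by simp)
  have hΩm := hΩo.measurableSet
  have : IsFiniteMeasure (volume.restrict Ω) := ⟨by simpa using hΩb.measure_lt_top⟩
  obtain ⟨K, hK⟩ := exists_bound_fderiv hΩo hΩb (hqs.of_le (by norm_num))
  obtain ⟨K0, hK0⟩ := hΩb.isCompact_closure.exists_bound_of_continuousOn hqs.continuousOn
  -- all the functions involved are essentially bounded on `Ω`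
  have mq : MemLp qs ⊤ (volume.restrict Ω) :=
    memLp_top_of_bound (hqΩ.continuousOn.aestronglyMeasurable hΩm) K0
      (ae_restrict_of_forall_mem hΩm fun p hp => hK0 p (subset_closure hp))
  have mdq (v : ℝ × ℝ) : MemLp (fun p => fderiv ℝ qs p v) ⊤ (volume.restrict Ω) :=
    memLp_top_of_bound (measurable_fderiv_apply_const ℝ qs v).aestronglyMeasurable (K * ‖v‖)
      (ae_restrict_of_forall_mem hΩm fun p hp => (fderiv ℝ qs p).le_of_opNorm_le (hK p hp) v)
  have mη : MemLp η ⊤ (volume.restrict Ω) :=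
    hη.continuous.memLp_top_of_hasCompactSupport hηs _
  have mdη (v : ℝ × ℝ) : MemLp (fun p => fderiv ℝ η p v) ⊤ (volume.restrict Ω) :=
    ((hη.continuous_fderiv (by simp)).clm_apply continuous_const).memLp_top_of_hasCompactSupport
      (hηs.fderiv_apply ℝ v) _
  have mx : MemLp (pdx qs) ⊤ (volume.restrict Ω) := mdq _
  have my : MemLp (pdy qs) ⊤ (volume.restrict Ω) := mdq _
  have nx : MemLp (pdx η) ⊤ (volume.restrict Ω) := mdη _
  have ny : MemLp (pdy η) ⊤ (volume.restrict Ω) := mdη _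
  have mul {f g : ℝ × ℝ → ℝ} (hf : MemLp f ⊤ (volume.restrict Ω))
      (hg : MemLp g ⊤ (volume.restrict Ω)) : MemLp (fun p => f p * g p) ⊤ (volume.restrict Ω) :=
    hg.mul' hf
  have cst (c : ℝ) : MemLp (fun _ : ℝ × ℝ => c) ⊤ (volume.restrict Ω) := memLp_const c
  have sq {f : ℝ × ℝ → ℝ} (hf : MemLp f ⊤ (volume.restrict Ω)) :
      MemLp (fun p => f p ^ 2) ⊤ (volume.restrict Ω) := by
    simpa only [pow_two] using mul hf hf
  have int {f : ℝ × ℝ → ℝ} (hf : MemLp f ⊤ (volume.restrict Ω)) :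
      Integrable f (volume.restrict Ω) := hf.integrable le_top
  -- the energy of `g • M1 - b • M3`
  let c₀ : ℝ := 3 * A * b ^ 2 + 2 * B * b ^ 3 + 9 * C * b ^ 4
  have hE (g : ℝ × ℝ → ℝ) (hg : ∀ p ∈ Ω, DifferentiableAt ℝ g p) :
      Ib (fun p => g p • M1 - b • M3) = ∫ p in Ω, (pdx g p ^ 2 + pdy g p ^ 2
        + k * (C * (g p ^ 2) ^ 2 - B ^ 2 / (2 * C) * g p ^ 2 + c₀)) := by
    rw [hIb]
    refine setIntegral_congr_fun hΩm fun p hp => ?_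
    rw [gradient_density_eq b (hg p hp), bulk_density_eq]
    simp only [c₀, hb, hA]
    field_simp
    ring
  let F₀ : ℝ × ℝ → ℝ := fun p => pdx qs p ^ 2 + pdy qs p ^ 2
    + k * (C * (qs p ^ 2) ^ 2 - B ^ 2 / (2 * C) * qs p ^ 2 + c₀)
  let F₁ : ℝ × ℝ → ℝ := fun p => pdx qs p * pdx η p + pdy qs p * pdy η p
    + k * (2 * C * (qs p ^ 2 * qs p) - B ^ 2 / (2 * C) * qs p) * η p
  let F₂ : ℝ × ℝ → ℝ := fun p => pdx η p ^ 2 + pdy η p ^ 2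
    + k * (6 * C * qs p ^ 2 - B ^ 2 / (2 * C)) * η p ^ 2
  let F₃ : ℝ × ℝ → ℝ := fun p => 4 * k * C * (qs p * (η p ^ 2 * η p))
  let F₄ : ℝ × ℝ → ℝ := fun p => k * C * (η p ^ 2) ^ 2
  have i₀ : Integrable F₀ (volume.restrict Ω) := int <| ((sq mx).add (sq my)).add <|
    mul (cst k) <| ((mul (cst C) (sq (sq mq))).sub (mul (cst (B ^ 2 / (2 * C))) (sq mq))).add
      (cst c₀)
  have i₁ : Integrable F₁ (volume.restrict Ω) := int <| ((mul mx nx).add (mul my ny)).add <|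
    mul (mul (cst k) ((mul (cst (2 * C)) (mul (sq mq) mq)).sub
      (mul (cst (B ^ 2 / (2 * C))) mq))) mη
  have i₂ : Integrable F₂ (volume.restrict Ω) := int <| ((sq nx).add (sq ny)).add <|
    mul (mul (cst k) ((mul (cst (6 * C)) (sq mq)).sub (cst (B ^ 2 / (2 * C))))) (sq mη)
  have i₃ : Integrable F₃ (volume.restrict Ω) :=
    int <| mul (cst (4 * k * C)) (mul mq (mul (sq mη) mη))
  have i₄ : Integrable F₄ (volume.restrict Ω) := int <| mul (cst (k * C)) (sq (sq mη))
  -- the first variation vanishes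
  have hF₁ : ∫ p in Ω, F₁ p = 0 := by
    obtain ⟨a1, a2, a3⟩ := setIntegral_fderiv_mul_fderiv hΩo hqΩ hη hηs hηsupp (1, 0)
    obtain ⟨b1, b2, b3⟩ := setIntegral_fderiv_mul_fderiv hΩo hqΩ hη hηs hηsupp (0, 1)
    have : ∫ p in Ω, F₁ p = ∫ p in Ω,
        ((fderiv ℝ qs p (1, 0) * fderiv ℝ η p (1, 0) + fderiv ℝ qs p (0, 1) * fderiv ℝ η p (0, 1))
        + (fderiv ℝ (fun r => fderiv ℝ qs r (1, 0)) p (1, 0) * η p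
          + fderiv ℝ (fun r => fderiv ℝ qs r (0, 1)) p (0, 1) * η p)) := by
      refine setIntegral_congr_fun hΩm fun p hp => ?_
      have h := heq p hp
      rw [lap2_eq_fderiv hΩo hqΩ hp] at h
      simp only [F₁, pdx, pdy]
      linear_combination (-η p) * h
    rw [this, integral_add (a1.fun_add b1).integrableOn (a2.fun_add b2).integrableOn,
      integral_add a1.integrableOn b1.integrableOn, integral_add a2.integrableOn b2.integrableOn,
      a3, b3]
    ring
  obtain ⟨δ, hδ, hneg'⟩ := exists_pos_quartic_neg hneg (∫ p in Ω, F₃ p) (∫ p in Ω, F₄ p)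
  refine ⟨δ, hδ, fun t ht htδ => ?_⟩
  have hQ : Qs = fun p => qs p • M1 - b • M3 := funext hQs
  have hQV : (fun p => Qs p + t • V p) = fun p => (qs p + t * η p) • M1 - b • M3 := by
    funext p
    rw [hQs, hV, add_smul, smul_smul]
    abel
  have hexp : ∫ p in Ω, (pdx (fun p => qs p + t * η p) p ^ 2 + pdy (fun p => qs p + t * η p) p ^ 2
        + k * (C * ((qs p + t * η p) ^ 2) ^ 2 - B ^ 2 / (2 * C) * (qs p + t * η p) ^ 2 + c₀))
      = ∫ p in Ω, (F₀ p + 2 * t * F₁ p + t ^ 2 * F₂ p + t ^ 3 * F₃ p + t ^ 4 * F₄ p) := by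
    refine setIntegral_congr_fun hΩm fun p hp => ?_
    have hf : fderiv ℝ (fun p => qs p + t * η p) p = fderiv ℝ qs p + t • fderiv ℝ η p :=
      ((hqd p hp).hasFDerivAt.add ((hηd p).hasFDerivAt.const_mul t)).fderiv
    simp only [pdx, pdy, hf, F₀, F₁, F₂, F₃, F₄, _root_.add_apply,
      _root_.smul_apply, smul_eq_mul]
    ring
  rw [hQV, hQ, hE qs hqd,
    hE (fun p => qs p + t * η p) fun p hp => (hqd p hp).add ((hηd p).const_mul t), hexp,
    integral_add (((i₀.fun_add (i₁.const_mul _)).fun_add (i₂.const_mul _)).fun_add (i₃.const_mul _))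
      (i₄.const_mul _),
    integral_add ((i₀.fun_add (i₁.const_mul _)).fun_add (i₂.const_mul _)) (i₃.const_mul _),
    integral_add (i₀.fun_add (i₁.const_mul _)) (i₂.const_mul _),
    integral_add i₀ (i₁.const_mul _)]
  simp only [integral_const_mul, hF₁]
  have := hneg' t ht htδ
  change (∫ p in Ω, F₀ p) + 2 * t * 0 + t ^ 2 * (∫ p in Ω, F₂ p) + t ^ 3 * (∫ p in Ω, F₃ p)
    + t ^ 4 * (∫ p in Ω, F₄ p) < ∫ p in Ω, F₀ p
  change t ^ 2 * (∫ p in Ω, F₂ p) + t ^ 3 * (∫ p in Ω, F₃ p) + t ^ 4 * (∫ p in Ω, F₄ p) < 0 at this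
  linarith
end
end
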